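/- Let (A,B) be a Katsura pair. The KEP-action (G_B, E_A) is regular if and only if the KEP-actions of both the infinite part (A_∞, B_∞) and the finite part (A_{<∞}, B_{<∞}) are regular. -/

import Mathlib

open scoped Classical

/-- A Katsura pair on a vertex set `V`: matrices `A` (natural entries) and `B` (integer
entries) with `A i j = 0 → B i j = 0`. -/
structure KatsuraPair (V : Type) where
  A : V → V → ℕ
  B : V → V → ℤ
  zero : ∀ i j, A i j = 0 → B i j = 0

namespace KatsuraPair

variable {V : Type}

/-- An edge `e_{i,j,m}` (with `0 ≤ m < A i j`) of the graph `E_A`; the range is `i` and the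
source is `j`. -/
structure Edge (P : KatsuraPair V) where
  i : V
  j : V
  m : ℕ
  hm : m < P.A i j

variable {P : KatsuraPair V}

/-- A finite path `μ = μ₁⋯μₙ`: consecutive edges satisfy `s(μₜ) = r(μₜ₊₁)`. -/
def IsPath (μ : List (Edge P)) : Prop := μ.Chain' (fun e f => e.j = f.i)

/-- `r(μ) = v` (vacuously true for the empty path, viewed as a vertex). -/
def rangeIs (μ : List (Edge P)) (v : V) : Prop := ∀ e ∈ μ.head?, e.i = v

/-- The source of a path whose range is `v` (so `s` of the empty path at `v` is `v`). -/
def src (v : V) (μ : List (Edge P)) : V := (μ.getLast?).elim v (fun e => e.j)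

/-- `A_μ`, the product of the `A`-entries along `μ` (empty product is 1). -/
def Aprod (μ : List (Edge P)) : ℕ := (μ.map (fun e => P.A e.i e.j)).prod

/-- `B_μ`, the product of the `B`-entries along `μ` (empty product is 1). -/
def Bprod (μ : List (Edge P)) : ℤ := (μ.map (fun e => P.B e.i e.j)).prod

/-- `a^k · e_{i,j,m} = e_{i,j,m̂}` where `k·B i j + m = k̂·(A i j) + m̂`, `0 ≤ m̂ < A i j`. -/
def edgeAct (k : ℤ) (e : Edge P) : Edge P where
  i := e.i
  j := e.j
  m := ((k * P.B e.i e.j + (e.m : ℤ)) % (P.A e.i e.j : ℤ)).toNat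
  hm := by
    have hA : 0 < P.A e.i e.j := Nat.lt_of_le_of_lt (Nat.zero_le _) e.hm
    have hA' : (0 : ℤ) < (P.A e.i e.j : ℤ) := by exact_mod_cast hA
    have h1 : 0 ≤ (k * P.B e.i e.j + (e.m : ℤ)) % (P.A e.i e.j : ℤ) :=
      Int.emod_nonneg _ hA'.ne'
    have h2 : (k * P.B e.i e.j + (e.m : ℤ)) % (P.A e.i e.j : ℤ) < (P.A e.i e.j : ℤ) :=
      Int.emod_lt_of_pos _ hA'
    omega

/-- `a^k|_{e_{i,j,m}} = a^{k̂}` where `k·B i j + m = k̂·(A i j) + m̂`, `0 ≤ m̂ < A i j`. -/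
def edgeRes (k : ℤ) (e : Edge P) : ℤ := (k * P.B e.i e.j + (e.m : ℤ)) / (P.A e.i e.j : ℤ)

/-- The action of `a^k` on finite paths: `a^k · (eν) = (a^k · e)(a^k|_e · ν)`. -/
def act : ℤ → List (Edge P) → List (Edge P)
  | _, [] => []
  | k, e :: ν => edgeAct k e :: act (edgeRes k e) ν

/-- The restriction along a path: `a^k|_{eν} = (a^k|_e)|_ν`; `res k μ` is the integer with
`a^k|_μ = a^{res k μ}`. -/
def res : ℤ → List (Edge P) → ℤ
  | k, [] => k
  | k, e :: ν => res (edgeRes k e) ν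

/-- `a^k` and `a^l` act equally at the vertex `v`. -/
def ActEq (P : KatsuraPair V) (k l : ℤ) (v : V) : Prop :=
  ∀ μ : List (Edge P), IsPath μ → rangeIs μ v → act k μ = act l μ

/-- The KEP-action `(G_B, E_A)` is contracting. -/
def Contracting (P : KatsuraPair V) : Prop :=
  ∃ F : Finset ℤ, ∀ k : ℤ, ∀ v : V, ∃ n : ℕ, ∀ μ : List (Edge P),
    IsPath μ → rangeIs μ v → n ≤ μ.length →
    ∃ l ∈ F, ActEq P (res k μ) l (src v μ)

/-- The KEP-action `(G_B, E_A)` is regular. -/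
def Regular (P : KatsuraPair V) : Prop :=
  ∀ k : ℤ, ∀ v : V, ∃ K : ℕ, ∀ μ : List (Edge P),
    IsPath μ → rangeIs μ v → K ≤ μ.length → act k μ = μ →
    ActEq P (res k μ) 0 (src v μ)

/-- `v ∈ E⁰_{A,<∞}`: the quantity `A_μ / gcd(A_μ, |B_μ|)` is bounded over paths `μ` with
range `v` and `B_μ ≠ 0`. -/
def FiniteVertex (P : KatsuraPair V) (v : V) : Prop :=
  ∃ C : ℕ, ∀ μ : List (Edge P), IsPath μ → rangeIs μ v → Bprod μ ≠ 0 →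
    Aprod μ / Nat.gcd (Aprod μ) (Bprod μ).natAbs ≤ C

/-- An edge of `E_{A,∞}`: `B` nonzero and source in `E⁰_{A,∞}`. -/
def InfEdge (e : Edge P) : Prop := P.B e.i e.j ≠ 0 ∧ ¬ FiniteVertex P e.j

/-- An edge of `E_{A,<∞}`: `B` nonzero and range in `E⁰_{A,<∞}`. -/
def FinEdge (e : Edge P) : Prop := P.B e.i e.j ≠ 0 ∧ FiniteVertex P e.i

/-- The infinite part `(A_∞, B_∞)` of a Katsura pair. -/
def infinitePart (P : KatsuraPair V) : KatsuraPair {v : V // ¬ FiniteVertex P v} where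
  A := fun i j => if P.B i.1 j.1 = 0 then 0 else P.A i.1 j.1
  B := fun i j => P.B i.1 j.1
  zero := fun i j h => by
    by_cases hb : P.B i.1 j.1 = 0
    · exact hb
    · simp only [if_neg hb] at h
      exact P.zero _ _ h

/-- The finite part `(A_{<∞}, B_{<∞})` of a Katsura pair. -/
def finitePart (P : KatsuraPair V) : KatsuraPair {v : V // FiniteVertex P v} where
  A := fun i j => if P.B i.1 j.1 = 0 then 0 else P.A i.1 j.1
  B := fun i j => P.B i.1 j.1
  zero := fun i j h => by
    by_cases hb : P.B i.1 j.1 = 0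
    · exact hb
    · simp only [if_neg hb] at h
      exact P.zero _ _ h

end KatsuraPair

namespace KatsuraPair

section Basic

variable {V : Type} {P : KatsuraPair V}

theorem Edge.ext' {e f : Edge P} (hi : e.i = f.i) (hj : e.j = f.j) (hm : e.m = f.m) : e = f := by
  cases e; cases f; cases hi; cases hj; cases hm; rfl

theorem Edge.A_pos (e : Edge P) : 0 < P.A e.i e.j := Nat.zero_lt_of_lt e.hm

theorem isPath_nil : IsPath ([] : List (Edge P)) := List.isChain_nil

theorem isPath_cons {e : Edge P} {ν : List (Edge P)} :
    IsPath (e :: ν) ↔ rangeIs ν e.j ∧ IsPath ν := by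
  have h : IsPath (e :: ν) ↔ (∀ f ∈ ν.head?, e.j = f.i) ∧ IsPath ν := List.isChain_cons
  simpa only [rangeIs, eq_comm] using h

theorem rangeIs_nil (v : V) : rangeIs ([] : List (Edge P)) v := by
  simp [rangeIs]

theorem rangeIs_cons {e : Edge P} {ν : List (Edge P)} {v : V} :
    rangeIs (e :: ν) v ↔ e.i = v := by
  simp [rangeIs]

theorem src_cons (e : Edge P) (ν : List (Edge P)) (v : V) :
    src v (e :: ν) = src e.j ν := by
  cases ν with
  | nil => simp [src]
  | cons f ν => simp [src, List.getLast?_eq_some_getLast]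

theorem edgeAct_eq_self_iff {k : ℤ} {e : Edge P} :
    edgeAct k e = e ↔ (P.A e.i e.j : ℤ) ∣ k * P.B e.i e.j := by
  have hA : (0 : ℤ) < P.A e.i e.j := by exact_mod_cast e.A_pos
  have hm : (e.m : ℤ) % (P.A e.i e.j : ℤ) = e.m :=
    Int.emod_eq_of_lt (by positivity) (by exact_mod_cast e.hm)
  have hnn := Int.emod_nonneg (k * P.B e.i e.j + (e.m : ℤ)) hA.ne'
  constructor
  · intro h
    have h1 : ((k * P.B e.i e.j + (e.m : ℤ)) % (P.A e.i e.j : ℤ)).toNat = e.m :=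
      congrArg Edge.m h
    have h2 : (k * P.B e.i e.j + (e.m : ℤ)) % (P.A e.i e.j : ℤ) = e.m := by omega
    simpa using Int.dvd_self_sub_of_emod_eq h2
  · intro h
    refine Edge.ext' rfl rfl ?_
    change ((k * P.B e.i e.j + (e.m : ℤ)) % (P.A e.i e.j : ℤ)).toNat = e.m
    obtain ⟨c, hc⟩ := h
    rw [hc, add_comm, Int.add_mul_emod_self_left, hm]
    simp

theorem edgeRes_mul_A {k : ℤ} {e : Edge P} (h : edgeAct k e = e) :
    edgeRes k e * P.A e.i e.j = k * P.B e.i e.j := by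
  have hA : (0 : ℤ) < P.A e.i e.j := by exact_mod_cast e.A_pos
  obtain ⟨c, hc⟩ := edgeAct_eq_self_iff.1 h
  have hm : (e.m : ℤ) / (P.A e.i e.j : ℤ) = 0 :=
    Int.ediv_eq_zero_of_lt (by positivity) (by exact_mod_cast e.hm)
  rw [edgeRes, hc, add_comm, Int.add_mul_ediv_left _ _ hA.ne', hm]
  ring

theorem edgeAct_of_B_eq_zero {e : Edge P} (h : P.B e.i e.j = 0) (k : ℤ) : edgeAct k e = e :=
  edgeAct_eq_self_iff.2 (by simp [h])

theorem edgeRes_of_B_eq_zero {e : Edge P} (h : P.B e.i e.j = 0) (k : ℤ) : edgeRes k e = 0 := by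
  have h1 := edgeRes_mul_A (edgeAct_of_B_eq_zero h k)
  rw [h, mul_zero] at h1
  exact (mul_eq_zero.1 h1).resolve_right (by exact_mod_cast e.A_pos.ne')

theorem edgeAct_zero (e : Edge P) : edgeAct 0 e = e :=
  edgeAct_eq_self_iff.2 (by simp)

theorem edgeRes_zero (e : Edge P) : edgeRes 0 e = 0 := by
  have h1 := edgeRes_mul_A (edgeAct_zero e)
  rw [zero_mul] at h1
  exact (mul_eq_zero.1 h1).resolve_right (by exact_mod_cast e.A_pos.ne')

theorem act_zero (μ : List (Edge P)) : act 0 μ = μ := by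
  induction μ with
  | nil => rfl
  | cons e ν ih => rw [act, edgeAct_zero, edgeRes_zero, ih]

theorem actEq_zero_iff {k : ℤ} {v : V} :
    ActEq P k 0 v ↔
      ∀ e : Edge P, e.i = v → edgeAct k e = e ∧ ActEq P (edgeRes k e) 0 e.j := by
  constructor
  · intro h e he
    refine ⟨?_, fun ν hν hr => ?_⟩
    · have := h [e] (isPath_cons.2 ⟨rangeIs_nil _, isPath_nil⟩) (rangeIs_cons.2 he)
      rw [act_zero] at this
      exact (List.cons.inj this).1
    · have := h (e :: ν) (isPath_cons.2 ⟨hr, hν⟩) (rangeIs_cons.2 he)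
      rw [act_zero] at this
      rw [act_zero]
      exact (List.cons.inj this).2
  · intro h μ hμ hr
    cases μ with
    | nil => rfl
    | cons e ν =>
      obtain ⟨h1, h2⟩ := h e (rangeIs_cons.1 hr)
      obtain ⟨h3, h4⟩ := isPath_cons.1 hμ
      have := h2 ν h4 h3
      rw [act_zero] at this ⊢
      rw [act, h1, this]

/-- Every path of length `n` with range `v` fixed by `a^k` has a restriction that acts trivially
at the source. -/
def RegularAt (P : KatsuraPair V) : ℕ → ℤ → V → Prop
  | 0, k, v => ActEq P k 0 v
  | n + 1, k, v => ∀ e : Edge P, e.i = v → edgeAct k e = e → RegularAt P n (edgeRes k e) e.j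

theorem RegularAt.succ {n : ℕ} {k : ℤ} {v : V} (h : RegularAt P n k v) :
    RegularAt P (n + 1) k v := by
  induction n generalizing k v with
  | zero => exact fun e he _ => (actEq_zero_iff.1 h e he).2
  | succ n ih => exact fun e he hk => ih (h e he hk)

theorem RegularAt.mono {m n : ℕ} (hmn : m ≤ n) {k : ℤ} {v : V} (h : RegularAt P m k v) :
    RegularAt P n k v := by
  induction hmn with
  | refl => exact h
  | step _ ih => exact ih.succ

theorem regularAt_zero_zero (v : V) : RegularAt P 0 0 v := fun _ _ _ => rfl

theorem RegularAt.actEq {n : ℕ} {k : ℤ} {v : V} (h : RegularAt P n k v) {μ : List (Edge P)}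
    (hμ : IsPath μ) (hr : rangeIs μ v) (hn : n ≤ μ.length) (hk : act k μ = μ) :
    ActEq P (res k μ) 0 (src v μ) := by
  induction μ generalizing n k v with
  | nil =>
    obtain rfl : n = 0 := by simpa using hn
    exact h
  | cons e ν ih =>
    obtain ⟨h1, h2⟩ := List.cons.inj hk
    obtain ⟨h3, h4⟩ := isPath_cons.1 hμ
    rw [src_cons]
    have h5 : RegularAt P ν.length (edgeRes k e) e.j :=
      h.mono hn e (rangeIs_cons.1 hr) h1
    exact ih h5 h4 h3 le_rfl h2

theorem regularAt_of_actEq {n : ℕ} {k : ℤ} {v : V}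
    (h : ∀ μ : List (Edge P), IsPath μ → rangeIs μ v → n ≤ μ.length → act k μ = μ →
      ActEq P (res k μ) 0 (src v μ)) : RegularAt P n k v := by
  induction n generalizing k v with
  | zero => exact h [] isPath_nil (rangeIs_nil v) le_rfl rfl
  | succ n ih =>
    intro e he hk
    refine ih fun ν hν hr hn hfix => ?_
    have := h (e :: ν) (isPath_cons.2 ⟨hr, hν⟩) (rangeIs_cons.2 he) (by simpa using hn)
      (by rw [act, hk, hfix])
    rwa [src_cons] at this

theorem regular_iff_regularAt : Regular P ↔ ∀ k v, ∃ n, RegularAt P n k v := by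
  constructor
  · intro h k v
    obtain ⟨n, hn⟩ := h k v
    exact ⟨n, regularAt_of_actEq hn⟩
  · intro h k v
    obtain ⟨n, hn⟩ := h k v
    exact ⟨n, fun μ hμ hr hl hk => hn.actEq hμ hr hl hk⟩

end Basic

section Restriction

variable {V : Type} {P : KatsuraPair V} {p : V → Prop}

/-- The Katsura pair induced on the vertices satisfying `p`, without the edges on which `B`
vanishes. -/
def restrict (P : KatsuraPair V) (p : V → Prop) : KatsuraPair {v : V // p v} where
  A := fun i j => if P.B i.1 j.1 = 0 then 0 else P.A i.1 j.1
  B := fun i j => P.B i.1 j.1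
  zero := fun i j h => by
    by_cases hb : P.B i.1 j.1 = 0
    · exact hb
    · simp only [if_neg hb] at h
      exact P.zero _ _ h

theorem restrict_B_ne_zero (e : Edge (P.restrict p)) : P.B e.i.1 e.j.1 ≠ 0 := by
  intro h
  have := e.A_pos
  simp [restrict, h] at this

theorem restrict_A (e : Edge (P.restrict p)) :
    (P.restrict p).A e.i e.j = P.A e.i.1 e.j.1 := if_neg (restrict_B_ne_zero e)

/-- An edge of the restricted pair, viewed in the original graph. -/
def Edge.lift (e : Edge (P.restrict p)) : Edge P :=
  ⟨e.i.1, e.j.1, e.m, restrict_A e ▸ e.hm⟩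

theorem exists_lift_eq (e : Edge P) (hB : P.B e.i e.j ≠ 0) (hi : p e.i) (hj : p e.j) :
    ∃ f : Edge (P.restrict p), f.i = ⟨e.i, hi⟩ ∧ f.j = ⟨e.j, hj⟩ ∧ f.lift = e :=
  ⟨⟨⟨e.i, hi⟩, ⟨e.j, hj⟩, e.m, by simpa [restrict, hB] using e.hm⟩, rfl, rfl, rfl⟩

theorem edgeAct_lift_iff {k : ℤ} {e : Edge (P.restrict p)} :
    edgeAct k e.lift = e.lift ↔ edgeAct k e = e := by
  rw [edgeAct_eq_self_iff, edgeAct_eq_self_iff, restrict_A]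
  rfl

theorem edgeRes_lift (k : ℤ) (e : Edge (P.restrict p)) : edgeRes k e.lift = edgeRes k e := by
  unfold edgeRes
  rw [restrict_A]
  rfl

theorem actEq_restrict {k : ℤ} {v : {v : V // p v}} (h : ActEq P k 0 v.1) :
    ActEq (P.restrict p) k 0 v := by
  intro μ hμ hr
  rw [act_zero]
  induction μ generalizing k v with
  | nil => rfl
  | cons e ν ih =>
    have he := rangeIs_cons.1 hr
    obtain ⟨h1, h2⟩ := actEq_zero_iff.1 h e.lift (congrArg Subtype.val he)
    rw [edgeRes_lift] at h2
    obtain ⟨h3, h4⟩ := isPath_cons.1 hμ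
    rw [act, edgeAct_lift_iff.1 h1, ih h2 h4 h3]

theorem RegularAt.restrict {n : ℕ} {k : ℤ} {v : {v : V // p v}} (h : RegularAt P n k v.1) :
    RegularAt (P.restrict p) n k v := by
  induction n generalizing k v with
  | zero => exact actEq_restrict h
  | succ n ih =>
    intro e he hk
    have := h e.lift (congrArg Subtype.val he) (edgeAct_lift_iff.2 hk)
    rw [edgeRes_lift] at this
    exact ih this

theorem Regular.restrict (h : Regular P) (p : V → Prop) : Regular (P.restrict p) := by
  rw [regular_iff_regularAt] at h ⊢
  intro k v
  obtain ⟨n, hn⟩ := h k v.1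
  exact ⟨n, hn.restrict⟩

theorem actEq_of_restrict (hp : ∀ e : Edge P, P.B e.i e.j ≠ 0 → p e.i → p e.j)
    {k : ℤ} {v : V} (hv : p v) (h : ActEq (P.restrict p) k 0 ⟨v, hv⟩) : ActEq P k 0 v := by
  intro μ hμ hr
  rw [act_zero]
  induction μ generalizing k v with
  | nil => rfl
  | cons e ν ih =>
    obtain rfl := rangeIs_cons.1 hr
    obtain ⟨h3, h4⟩ := isPath_cons.1 hμ
    by_cases hB : P.B e.i e.j = 0
    · rw [act, edgeAct_of_B_eq_zero hB, edgeRes_of_B_eq_zero hB, act_zero]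
    · obtain ⟨f, hi, hj, hf⟩ := exists_lift_eq e hB hv (hp e hB hv)
      obtain ⟨h1, h2⟩ := actEq_zero_iff.1 h f hi
      rw [← edgeAct_lift_iff, hf] at h1
      rw [← edgeRes_lift, hf, hj] at h2
      rw [act, h1, ih _ h2 h4 h3]

theorem RegularAt.of_restrict (hp : ∀ e : Edge P, P.B e.i e.j ≠ 0 → p e.i → p e.j)
    {n : ℕ} {k : ℤ} {v : V} (hv : p v) (h : RegularAt (P.restrict p) n k ⟨v, hv⟩) :
    RegularAt P n k v := by
  induction n generalizing k v with
  | zero => exact actEq_of_restrict hp hv h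
  | succ n ih =>
    rintro e rfl hk
    by_cases hB : P.B e.i e.j = 0
    · rw [edgeRes_of_B_eq_zero hB]
      exact (regularAt_zero_zero _).mono n.zero_le
    · obtain ⟨f, hi, hj, hf⟩ := exists_lift_eq e hB hv (hp e hB hv)
      have h2 := h f hi (edgeAct_lift_iff.1 (by rw [hf, hk]))
      rw [← edgeRes_lift, hf, hj] at h2
      exact ih _ h2

end Restriction

section FiniteVertex

variable {V : Type} {P : KatsuraPair V}

theorem Aprod_cons (e : Edge P) (ν : List (Edge P)) :
    Aprod (e :: ν) = P.A e.i e.j * Aprod ν := by simp [Aprod]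

theorem Bprod_cons (e : Edge P) (ν : List (Edge P)) :
    Bprod (e :: ν) = P.B e.i e.j * Bprod ν := by simp [Bprod]

theorem Aprod_pos (μ : List (Edge P)) : 0 < Aprod μ := by
  induction μ with
  | nil => simp [Aprod]
  | cons e ν ih => rw [Aprod_cons]; exact Nat.mul_pos e.A_pos ih

theorem finiteVertex_iff {v : V} :
    FiniteVertex P v ↔ ∃ D : ℤ, D ≠ 0 ∧ ∀ μ : List (Edge P), IsPath μ → rangeIs μ v →
      (Aprod μ : ℤ) ∣ D * Bprod μ := by
  constructor
  · rintro ⟨C, hC⟩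
    refine ⟨(C.factorial : ℤ), by exact_mod_cast C.factorial_ne_zero, fun μ hμ hr => ?_⟩
    by_cases hB : Bprod μ = 0
    · simp [hB]
    · have hg := Nat.gcd_dvd_left (Aprod μ) (Bprod μ).natAbs
      have hpos : 0 < Aprod μ / Nat.gcd (Aprod μ) (Bprod μ).natAbs :=
        Nat.div_pos (Nat.le_of_dvd (Aprod_pos μ) hg) (Nat.gcd_pos_of_pos_left _ (Aprod_pos μ))
      have hd := mul_dvd_mul (Nat.dvd_factorial hpos (hC μ hμ hr hB))
        (Nat.gcd_dvd_right (Aprod μ) (Bprod μ).natAbs)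
      rw [Nat.div_mul_cancel hg] at hd
      rw [← Int.natAbs_dvd_natAbs, Int.natAbs_mul]
      simpa using hd
  · rintro ⟨D, hD, h⟩
    refine ⟨D.natAbs, fun μ hμ hr _ => Nat.le_of_dvd (Int.natAbs_pos.2 hD) ?_⟩
    have hd := h μ hμ hr
    rw [← Int.natAbs_dvd_natAbs, Int.natAbs_mul, Int.natAbs_natCast] at hd
    have hgpos := Nat.gcd_pos_of_pos_left (Bprod μ).natAbs (Aprod_pos μ)
    refine (Nat.coprime_div_gcd_div_gcd hgpos).dvd_of_dvd_mul_right ?_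
    rw [← Nat.mul_div_assoc _ (Nat.gcd_dvd_right _ _)]
    exact Nat.div_dvd_div (Nat.gcd_dvd_left _ _) hd

theorem FiniteVertex.source (e : Edge P) (hB : P.B e.i e.j ≠ 0) (h : FiniteVertex P e.i) :
    FiniteVertex P e.j := by
  obtain ⟨D, hD, h⟩ := finiteVertex_iff.1 h
  refine finiteVertex_iff.2 ⟨D * P.B e.i e.j, mul_ne_zero hD hB, fun ν hν hr => ?_⟩
  have := h (e :: ν) (isPath_cons.2 ⟨hr, hν⟩) (rangeIs_cons.2 rfl)
  rw [Aprod_cons, Bprod_cons, ← mul_assoc] at this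
  exact (Dvd.intro_left _ (by push_cast; rfl)).trans this

theorem exists_common_denominator [Finite V] (P : KatsuraPair V) :
    ∃ D : ℤ, D ≠ 0 ∧ ∀ v, FiniteVertex P v → ∀ μ : List (Edge P), IsPath μ → rangeIs μ v →
      (Aprod μ : ℤ) ∣ D * Bprod μ := by
  cases nonempty_fintype V
  have h : ∀ v, ∃ D : ℤ, D ≠ 0 ∧ (FiniteVertex P v → ∀ μ : List (Edge P), IsPath μ →
      rangeIs μ v → (Aprod μ : ℤ) ∣ D * Bprod μ) := by
    intro v
    by_cases hv : FiniteVertex P v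
    · obtain ⟨D, hD, h⟩ := finiteVertex_iff.1 hv
      exact ⟨D, hD, fun _ => h⟩
    · exact ⟨1, one_ne_zero, fun hv' => absurd hv' hv⟩
  choose D hD h using h
  refine ⟨∏ v, D v, Finset.prod_ne_zero_iff.2 fun v _ => hD v, fun v hv μ hμ hr => ?_⟩
  exact (h v hv μ hμ hr).trans
    (mul_dvd_mul_right (Finset.dvd_prod_of_mem D (Finset.mem_univ v)) _)

instance finite_edge [Finite V] : Finite (Edge P) :=
  Finite.of_injective
    (fun e : Edge P => (⟨(e.i, e.j), e.m, e.hm⟩ : Σ q : V × V, Fin (P.A q.1 q.2))) (by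
      rintro ⟨i, j, m, hm⟩ ⟨i', j', m', hm'⟩ h
      simp only [Sigma.mk.injEq, Prod.mk.injEq] at h
      obtain ⟨⟨rfl, rfl⟩, h⟩ := h
      simpa using h)

theorem exists_common_multiple [Finite V] (P : KatsuraPair V) :
    ∃ M : ℤ, M ≠ 0 ∧ ∀ e : Edge P, (P.A e.i e.j : ℤ) ∣ M := by
  cases nonempty_fintype (Edge P)
  exact ⟨∏ e : Edge P, (P.A e.i e.j : ℤ),
    Finset.prod_ne_zero_iff.2 fun e _ => by exact_mod_cast e.A_pos.ne',
    fun e => Finset.dvd_prod_of_mem (fun e : Edge P => (P.A e.i e.j : ℤ)) (Finset.mem_univ e)⟩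

/-- On the infinite part, only `a^0` acts trivially at a vertex. -/
theorem eq_zero_of_actEq_infinite [Finite V] {k : ℤ} {v : V} (hv : ¬ FiniteVertex P v)
    (h : ActEq (P.restrict fun v => ¬ FiniteVertex P v) k 0 ⟨v, hv⟩) : k = 0 := by
  obtain ⟨D, hD, hDdvd⟩ := exists_common_denominator P
  obtain ⟨M, hM, hMdvd⟩ := exists_common_multiple P
  by_contra hk
  refine hv (finiteVertex_iff.2
    ⟨k * (M * D), mul_ne_zero hk (mul_ne_zero hM hD), fun μ hμ hr => ?_⟩)
  clear hk
  induction μ generalizing k v with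
  | nil => simp [Aprod]
  | cons e ν ih =>
    obtain rfl := rangeIs_cons.1 hr
    obtain ⟨h3, h4⟩ := isPath_cons.1 hμ
    rw [Aprod_cons, Bprod_cons]
    push_cast
    by_cases hB : P.B e.i e.j = 0
    · simp [hB]
    by_cases hj : FiniteVertex P e.j
    · have hd := mul_dvd_mul (hMdvd e) (hDdvd e.j hj ν h4 h3)
      exact hd.trans ⟨k * P.B e.i e.j, by ring⟩
    · obtain ⟨f, hfi, hfj, hf⟩ :=
        exists_lift_eq (p := fun v => ¬ FiniteVertex P v) e hB hv hj
      obtain ⟨h1, h2⟩ := actEq_zero_iff.1 h f hfi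
      rw [← edgeAct_lift_iff, hf] at h1
      rw [← edgeRes_lift, hf, hfj] at h2
      have hd := mul_dvd_mul_left (P.A e.i e.j : ℤ) (ih hj h2 h4 h3)
      refine hd.trans (dvd_of_eq ?_)
      linear_combination M * D * Bprod ν * edgeRes_mul_A h1

theorem exists_regularAt_succ [Finite V] {k : ℤ} {v : V}
    (h : ∀ e : Edge P, e.i = v → edgeAct k e = e → ∃ n, RegularAt P n (edgeRes k e) e.j) :
    ∃ n, RegularAt P n k v := by
  have h' : ∀ e : Edge P, ∃ n, e.i = v → edgeAct k e = e → RegularAt P n (edgeRes k e) e.j := by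
    intro e
    by_cases he : e.i = v ∧ edgeAct k e = e
    · obtain ⟨n, hn⟩ := h e he.1 he.2
      exact ⟨n, fun _ _ => hn⟩
    · exact ⟨0, fun h1 h2 => absurd ⟨h1, h2⟩ he⟩
  choose n hn using h'
  obtain ⟨m, hm⟩ := Finite.exists_le n
  exact ⟨m + 1, fun e he hk => (hn e he hk).mono (hm e)⟩

theorem exists_regularAt_of_infinite [Finite V]
    (hfin : ∀ k v, FiniteVertex P v → ∃ n, RegularAt P n k v)
    {n : ℕ} {k : ℤ} {v : V} (hv : ¬ FiniteVertex P v)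
    (h : RegularAt (P.restrict fun v => ¬ FiniteVertex P v) n k ⟨v, hv⟩) :
    ∃ m, RegularAt P m k v := by
  induction n generalizing k v with
  | zero =>
    obtain rfl := eq_zero_of_actEq_infinite hv h
    exact ⟨0, regularAt_zero_zero v⟩
  | succ n ih =>
    refine exists_regularAt_succ ?_
    rintro e rfl hk
    by_cases hB : P.B e.i e.j = 0
    · rw [edgeRes_of_B_eq_zero hB]
      exact ⟨0, regularAt_zero_zero _⟩
    by_cases hj : FiniteVertex P e.j
    · exact hfin _ _ hj
    · obtain ⟨f, hfi, hfj, hf⟩ :=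
        exists_lift_eq (p := fun v => ¬ FiniteVertex P v) e hB hv hj
      have h2 := h f hfi (edgeAct_lift_iff.1 (by rw [hf, hk]))
      rw [← edgeRes_lift, hf, hfj] at h2
      exact ih hj h2

end FiniteVertex

end KatsuraPair

open KatsuraPair in
/-- the KEP-action `(G_B, E_A)` is regular iff the KEP-actions of both the
infinite part `(A_∞, B_∞)` and the finite part `(A_{<∞}, B_{<∞})` are regular. -/
theorem statement7 (N : ℕ) (hN : 0 < N) (P : KatsuraPair (Fin N)) :
    Regular P ↔ Regular (infinitePart P) ∧ Regular (finitePart P) := by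
  refine ⟨fun h => ⟨h.restrict _, h.restrict _⟩, fun ⟨hinf, hfin⟩ => ?_⟩
  rw [regular_iff_regularAt] at hinf hfin ⊢
  have hfin' : ∀ k v, FiniteVertex P v → ∃ n, RegularAt P n k v := by
    intro k v hv
    obtain ⟨n, hn⟩ := hfin k ⟨v, hv⟩
    exact ⟨n, RegularAt.of_restrict FiniteVertex.source hv hn⟩
  intro k v
  by_cases hv : FiniteVertex P v
  · exact hfin' k v hv
  · obtain ⟨n, hn⟩ := hinf k ⟨v, hv⟩
    exact exists_regularAt_of_infinite hfin' hv hn
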